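/- For every linear map Φ : V₁ → V₂, every alternating bilinear form σ on V₁, and every Lagrangian subspace F ⊆ V₂ ⊕ V₂*, the (Φ,σ)-backward image F^{Φ,σ} = {(v, Φ*(β) − σ♭(v)) : v ∈ V₁, β ∈ V₂*, (Φ(v), β) ∈ F} is a Lagrangian subspace of V₁ ⊕ V₁*. -/

import Mathlib

/-- A subset `S` of `V ⊕ V*` is Lagrangian when it coincides with its own orthogonal
complement with respect to the canonical split symmetric bilinear form
`⟨(v,α),(w,β)⟩ = α w + β v`. -/
def IsLagrangian {K V : Type*} [Field K] [AddCommGroup V] [Module K V]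
    (S : Set (V × Module.Dual K V)) : Prop :=
  ∀ y : V × Module.Dual K V, y ∈ S ↔ ∀ x ∈ S, x.2 y.1 + y.2 x.1 = 0

/-- A Lagrangian set is a linear subspace. -/
def IsLagrangian.toSubmodule {K V : Type*} [Field K] [AddCommGroup V] [Module K V]
    {S : Set (V × Module.Dual K V)} (hS : IsLagrangian S) :
    Submodule K (V × Module.Dual K V) where
  carrier := S
  zero_mem' := (hS 0).2 fun x _ => by simp
  add_mem' {a b} ha hb := (hS _).2 fun x hx => by
    have h₁ := (hS a).1 ha x hx
    have h₂ := (hS b).1 hb x hx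
    simp only [Prod.fst_add, Prod.snd_add, map_add, LinearMap.add_apply]
    linear_combination h₁ + h₂
  smul_mem' c a ha := (hS _).2 fun x hx => by
    have h := (hS a).1 ha x hx
    simp only [Prod.smul_fst, Prod.smul_snd, map_smul, LinearMap.smul_apply, smul_eq_mul]
    linear_combination c * h

/-- A functional vanishing on the kernel of a linear map factors through that map. -/
theorem LinearMap.exists_dual_comp_eq {K V W : Type*} [Field K] [AddCommGroup V] [Module K V]
    [AddCommGroup W] [Module K W] (T : V →ₗ[K] W) (l : Module.Dual K V)
    (h : ∀ x, T x = 0 → l x = 0) : ∃ β : Module.Dual K W, ∀ x, β (T x) = l x := by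
  have hl : l ∈ LinearMap.range T.dualMap := by
    rw [LinearMap.range_dualMap_eq_dualAnnihilator_ker, Submodule.mem_dualAnnihilator]
    exact fun x hx => h x hx
  obtain ⟨β, hβ⟩ := hl
  exact ⟨β, fun x => LinearMap.congr_fun hβ x⟩

/-- the `(Φ,σ)`-backward image of a Lagrangian subspace `F ⊆ V₂ ⊕ V₂*` is a
Lagrangian subspace of `V₁ ⊕ V₁*`. -/
theorem statement5 (K V₁ V₂ : Type*) [Field K]
    [AddCommGroup V₁] [Module K V₁] [FiniteDimensional K V₁]
    [AddCommGroup V₂] [Module K V₂] [FiniteDimensional K V₂]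
    (Φ : V₁ →ₗ[K] V₂) (σ : V₁ →ₗ[K] Module.Dual K V₁) (halt : ∀ v : V₁, σ v v = 0)
    (F : Set (V₂ × Module.Dual K V₂)) (hF : IsLagrangian F) :
    IsLagrangian {p : V₁ × Module.Dual K V₁ |
      ∃ (v : V₁) (β : Module.Dual K V₂), p = (v, Φ.dualMap β - σ v) ∧ (Φ v, β) ∈ F} := by
  have hskew (v w : V₁) : σ v w + σ w v = 0 := by
    have h := halt (v + w)
    simp only [map_add, LinearMap.add_apply] at h
    linear_combination h - halt v - halt w
  rintro ⟨w, γ⟩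
  constructor
  · rintro ⟨w₀, β₀, h, hmem⟩ _ ⟨v, β, rfl, hvβ⟩
    obtain ⟨rfl, rfl⟩ := Prod.mk.inj h
    have h := (hF _).1 hmem _ hvβ
    simp only [LinearMap.sub_apply, LinearMap.dualMap_apply] at h ⊢
    linear_combination h - hskew v w
  · intro hperp
    let ι := hF.toSubmodule.subtype
    let T : V₁ × hF.toSubmodule →ₗ[K] V₂ := Φ.coprod (-(LinearMap.fst K _ _ ∘ₗ ι))
    let l : Module.Dual K (V₁ × hF.toSubmodule) :=
      (γ + σ w).coprod (Module.Dual.eval K V₂ (Φ w) ∘ₗ LinearMap.snd K _ _ ∘ₗ ι)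
    have hker : ∀ x, T x = 0 → l x = 0 := by
      rintro ⟨v, ⟨⟨u, α⟩, hx⟩⟩ hT
      have hu : Φ v = u := by
        simpa [T, ι, ← sub_eq_add_neg, sub_eq_zero] using hT
      subst hu
      have h := hperp (v, Φ.dualMap α - σ v) ⟨v, α, rfl, hx⟩
      simp only [LinearMap.sub_apply, LinearMap.dualMap_apply] at h
      simp only [l, ι, LinearMap.coprod_apply, LinearMap.add_apply, LinearMap.comp_apply,
        Submodule.subtype_apply, LinearMap.snd_apply, Module.Dual.eval_apply]
      linear_combination h + hskew v w
    obtain ⟨β, hβ⟩ := LinearMap.exists_dual_comp_eq (V := V₁ × hF.toSubmodule) T l hker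
    refine ⟨w, β, Prod.ext rfl (LinearMap.ext fun v => ?_), (hF _).2 fun x hx => ?_⟩
    · have h := hβ (v, 0)
      simp only [T, l, LinearMap.coprod_apply, map_zero, add_zero, LinearMap.add_apply] at h
      simp only [LinearMap.sub_apply, LinearMap.dualMap_apply]
      linear_combination -h
    · have h := hβ (0, ⟨x, hx⟩)
      simp only [T, l, ι, LinearMap.coprod_apply, map_zero, zero_add, LinearMap.neg_apply,
        map_neg, LinearMap.comp_apply, Submodule.subtype_apply, LinearMap.fst_apply,
        LinearMap.snd_apply, Module.Dual.eval_apply] at h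
      linear_combination -h
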